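/- There exists a constant C > 0 such that for all real y ≥ 1 and all real μ, the series Σ_{k≥0} ((3^{2/3}μ/2)^k/k!)·(1/Γ((y+1−2k)/3)) converges absolutely and |A(y,μ)| ≤ C·e^{|μ|³/2}·(2/3)^{(y+1)/3}/Γ((y+1)/3). -/

import Mathlib

/-- `A(y,μ) = (e^{-μ³/6}/3^{(y+1)/3}) Σ_{k≥0} (3^{2/3}μ/2)^k/k! · 1/Γ((y+1-2k)/3)`;
note that Mathlib's `Real.Gamma` vanishes at nonpositive integers, so `(Real.Gamma z)⁻¹ = 0`
there, matching the convention. -/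
noncomputable def Afun (y μ : ℝ) : ℝ :=
  Real.exp (-μ ^ 3 / 6) / (3 : ℝ) ^ ((y + 1) / 3) *
    ∑' k : ℕ, ((3 : ℝ) ^ ((2 : ℝ) / 3) * μ / 2) ^ k / k.factorial *
      (Real.Gamma ((y + 1 - 2 * k) / 3))⁻¹

open Real in
/-- Log-convexity of `Γ`: for a fixed sum of the arguments, spreading them increases `Γ p * Γ q`. -/
theorem Real.Gamma_mul_Gamma_le_of_add_eq {p a b q : ℝ} (hp : 0 < p) (hpa : p ≤ a) (hpb : p ≤ b)
    (h : a + b = p + q) : Gamma a * Gamma b ≤ Gamma p * Gamma q := by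
  have ha : 0 < a := hp.trans_le hpa
  have hb : 0 < b := hp.trans_le hpb
  have hq : 0 < q := by linarith
  rcases eq_or_lt_of_le (show p ≤ q by linarith) with rfl | hpq
  · obtain rfl : a = p := by linarith
    obtain rfl : b = a := by linarith
    exact le_rfl
  have key : ∀ u v : ℝ, p ≤ u → p ≤ v → u + v = p + q →
      log (Gamma u) ≤ (q - u) / (q - p) * log (Gamma p) + (u - p) / (q - p) * log (Gamma q) := by
    intro u v hu hv huv
    have hd : 0 < q - p := by linarith
    have := convexOn_log_Gamma.2 (Set.mem_Ioi.2 hp) (Set.mem_Ioi.2 hq)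
      (div_nonneg (by linarith : 0 ≤ q - u) hd.le) (div_nonneg (by linarith : 0 ≤ u - p) hd.le)
      (by field_simp; ring)
    have e : ((q - u) / (q - p)) • p + ((u - p) / (q - p)) • q = u := by
      simp only [smul_eq_mul]; field_simp; ring
    rw [e] at this
    simpa using this
  have h1 := key a b hpa hpb h
  have h2 := key b a hpb hpa (by linarith)
  have hGp := Gamma_pos_of_pos hp
  have hGq := Gamma_pos_of_pos hq
  have hGa := Gamma_pos_of_pos ha
  have hGb := Gamma_pos_of_pos hb
  rw [← log_le_log_iff (by positivity) (by positivity), log_mul hGa.ne' hGb.ne',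
    log_mul hGp.ne' hGq.ne']
  have hd : q - p ≠ 0 := by linarith
  have e1 : (q - a) / (q - p) + (q - b) / (q - p) = 1 := by
    field_simp; linarith
  have e2 : (a - p) / (q - p) + (b - p) / (q - p) = 1 := by
    field_simp; linarith
  calc _ ≤ ((q - a) / (q - p) + (q - b) / (q - p)) * log (Gamma p) +
        ((a - p) / (q - p) + (b - p) / (q - p)) * log (Gamma q) := by linarith
    _ = _ := by rw [e1, e2]; ring

open Real in
theorem Real.Gamma_le_four_mul_Gamma_add_half {a : ℝ} (ha : 1 / 3 ≤ a) :
    Gamma a ≤ 4 * Gamma (a + 1 / 2) := by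
  have ha0 : 0 < a := by linarith
  have h := Gamma_mul_Gamma_le_of_add_eq (p := a + 1 / 2) (a := a + 1) (b := a + 1)
    (q := a + 1 / 2 + 1) (by linarith) (by linarith) (by linarith) (by ring)
  rw [Gamma_add_one ha0.ne', Gamma_add_one (by linarith)] at h
  have h1 := Gamma_pos_of_pos ha0
  have h2 := Gamma_pos_of_pos (show 0 < a + 1 / 2 by linarith)
  refine le_of_sq_le_sq ?_ (by positivity)
  have h3 : a + 1 / 2 ≤ 16 * a ^ 2 := by nlinarith
  have h4 : a ^ 2 * Gamma a ^ 2 ≤ a ^ 2 * (4 * Gamma (a + 1 / 2)) ^ 2 := by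
    nlinarith [mul_le_mul_of_nonneg_right h3 (sq_nonneg (Gamma (a + 1 / 2)))]
  exact le_of_mul_le_mul_left h4 (by positivity)

open Real in
/-- The bound for `s < x`, a real form of `(x-1 choose s) ≤ 2 ^ (x-1)` up to a constant. -/
theorem Real.Gamma_le_two_rpow_mul_Gamma_mul_Gamma_sub {x s : ℝ} (hx : 2 / 3 ≤ x) (hs : 0 ≤ s)
    (hsx : s < x) : Gamma x ≤ 2 * 2 ^ x * (Gamma (s + 1) * Gamma (x - s)) := by
  have hmid : Gamma ((x + 1) / 2) * Gamma ((x + 1) / 2) ≤ Gamma (s + 1) * Gamma (x - s) := by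
    rcases le_total (s + 1) (x - s) with h | h
    · exact Gamma_mul_Gamma_le_of_add_eq (by linarith) (by linarith) (by linarith) (by ring)
    · rw [mul_comm (Gamma (s + 1))]
      exact Gamma_mul_Gamma_le_of_add_eq (by linarith) (by linarith) (by linarith) (by ring)
  have hdup := Gamma_mul_Gamma_add_half (x / 2)
  have hhalf := Gamma_le_four_mul_Gamma_add_half (a := x / 2) (by linarith)
  rw [show x / 2 + 1 / 2 = (x + 1) / 2 by ring] at hdup hhalf
  rw [show 2 * (x / 2) = x by ring, rpow_sub two_pos, rpow_one] at hdup
  have hG := Gamma_pos_of_pos (show 0 < (x + 1) / 2 by linarith)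
  have hGx := Gamma_pos_of_pos (show 0 < x by linarith)
  have hpi : 1 ≤ √π := Real.one_le_sqrt.2 (by linarith [pi_gt_three])
  have hpow : (0 : ℝ) < 2 ^ x := by positivity
  have h1 : Gamma x * (2 / 2 ^ x) ≤ 4 * (Gamma (s + 1) * Gamma (x - s)) := by
    calc Gamma x * (2 / 2 ^ x) ≤ Gamma x * (2 / 2 ^ x) * √π :=
          le_mul_of_one_le_right (by positivity) hpi
      _ = Gamma (x / 2) * Gamma ((x + 1) / 2) := hdup.symm
      _ ≤ 4 * Gamma ((x + 1) / 2) * Gamma ((x + 1) / 2) := by gcongr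
      _ ≤ _ := by linarith
  rw [← mul_div_assoc, div_le_iff₀ hpow] at h1
  linarith

open Real in
theorem Real.Gamma_mul_abs_inv_Gamma_sub_le {x s : ℝ} (hx : 2 / 3 ≤ x) (hs : 0 ≤ s) :
    Gamma x * |(Gamma (x - s))⁻¹| ≤ 2 * 2 ^ x * Gamma (s + 1) := by
  have hx0 : 0 < x := by linarith
  have hGs := Gamma_pos_of_pos (show 0 < s + 1 by linarith)
  have hGx := Gamma_pos_of_pos hx0
  rcases lt_or_ge s x with h | h
  · have hG := Gamma_pos_of_pos (sub_pos.2 h)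
    rw [abs_of_pos (inv_pos.2 hG), ← div_eq_mul_inv, div_le_iff₀ hG, mul_assoc]
    exact Gamma_le_two_rpow_mul_Gamma_mul_Gamma_sub hx hs h
  · have hG := Gamma_pos_of_pos (show 0 < 1 - (x - s) by linarith)
    have href : (Gamma (x - s))⁻¹ = Gamma (1 - (x - s)) * (sin (π * (x - s)) / π) := by
      rw [← inv_div, ← Gamma_mul_Gamma_one_sub, mul_inv]
      field_simp
    have hsin : |sin (π * (x - s)) / π| ≤ 1 := by
      rw [abs_div, abs_of_pos pi_pos, div_le_one pi_pos]
      linarith [abs_sin_le_one (π * (x - s)), pi_gt_three]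
    have hle := Gamma_mul_Gamma_le_of_add_eq (p := 1) (a := x + 1) (b := 1 - (x - s))
      (q := s + 1) one_pos (by linarith) (by linarith) (by ring)
    rw [Gamma_one, one_mul, Gamma_add_one hx0.ne'] at hle
    have hpow : (1 : ℝ) ≤ 2 ^ x := one_le_rpow (by norm_num) hx0.le
    calc Gamma x * |(Gamma (x - s))⁻¹| ≤ Gamma x * (Gamma (1 - (x - s)) * 1) := by
          rw [href, abs_mul, abs_of_pos hG]; gcongr
      _ ≤ 2 * 1 * Gamma (s + 1) := by
          nlinarith [mul_pos hGx hG]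
      _ ≤ _ := by gcongr

open Real in
theorem Real.Gamma_le_Gamma_of_one_le {a b : ℝ} (ha : 1 ≤ a) (hb : 2 ≤ b) (hab : a ≤ b) :
    Gamma a ≤ Gamma b := by
  rcases le_total 2 a with h | h
  · exact Gamma_strictMonoOn_Ici.monotoneOn h hb hab
  · calc Gamma a ≤ max (Gamma 1) (Gamma 2) :=
        convexOn_Gamma.le_max_of_mem_Icc (by simp) (by simp) ⟨ha, h⟩
      _ = Gamma 2 := by simp
      _ ≤ Gamma b := Gamma_strictMonoOn_Ici.monotoneOn Set.self_mem_Ici hb hb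

open Nat in
theorem Nat.factorial_two_mul_mul_factorial_le (m : ℕ) :
    3 * 4 ^ m * ((2 * m)! * m !) ≤ 4 * (3 * m)! := by
  induction m with
  | zero => simp
  | succ m ih =>
    rcases Nat.eq_zero_or_pos m with rfl | hm
    · decide
    rw [show 2 * (m + 1) = 2 * m + 1 + 1 by ring, show 3 * (m + 1) = 3 * m + 1 + 1 + 1 by ring]
    simp only [Nat.factorial_succ, pow_succ]
    have h : 4 * ((2 * m + 1 + 1) * (2 * m + 1) * (m + 1)) ≤
        (3 * m + 1 + 1 + 1) * (3 * m + 1 + 1) * (3 * m + 1) := by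
      nlinarith [mul_pos hm hm, mul_pos (mul_pos hm hm) hm,
        Nat.mul_le_mul hm (le_refl m), Nat.mul_le_mul (Nat.mul_le_mul hm (le_refl m)) (le_refl m)]
    calc _ = 4 * ((2 * m + 1 + 1) * (2 * m + 1) * (m + 1)) *
          (3 * 4 ^ m * ((2 * m)! * m !)) := by ring
      _ ≤ _ := Nat.mul_le_mul h ih
      _ = _ := by ring

open Nat in
theorem Nat.factorial_add_mul_factorial_le {a b : ℕ} (h : a ≤ b) (j : ℕ) :
    (a + j)! * b ! ≤ a ! * (b + j)! := by
  induction j with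
  | zero => simp
  | succ j ih =>
    rw [← add_assoc, ← add_assoc, Nat.factorial_succ, Nat.factorial_succ]
    calc _ = (a + j + 1) * ((a + j)! * b !) := by ring
      _ ≤ (b + j + 1) * (a ! * (b + j)!) := by gcongr
      _ = _ := by ring

open Nat in
theorem Real.Gamma_two_thirds_mul_div_factorial_le (k : ℕ) :
    Real.Gamma (2 * k / 3 + 1) / k ! ≤ 4 / 3 * ((1 / 4) ^ (k / 3) / (k / 3)!) := by
  obtain ⟨m, j, hj, rfl⟩ : ∃ m j, j < 3 ∧ k = 3 * m + j :=
    ⟨k / 3, k % 3, Nat.mod_lt _ (by norm_num), (Nat.div_add_mod k 3).symm⟩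
  rw [show (3 * m + j) / 3 = m by omega]
  have hG : Real.Gamma (2 * (3 * m + j : ℕ) / 3 + 1) ≤ (2 * m + j)! := by
    rw [← Real.Gamma_nat_eq_factorial]
    push_cast
    rcases Nat.eq_zero_or_pos j with rfl | hj0
    · apply le_of_eq; congr 1; push_cast; ring
    have hj1 : (1 : ℝ) ≤ j := by exact_mod_cast hj0
    have hm0 : (0 : ℝ) ≤ m := m.cast_nonneg
    exact Real.Gamma_le_Gamma_of_one_le (by linarith) (by linarith) (by linarith)
  have h1 : ((2 * m + j)! * (3 * m)! : ℝ) ≤ (2 * m)! * (3 * m + j)! := by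
    exact_mod_cast Nat.factorial_add_mul_factorial_le (show 2 * m ≤ 3 * m by omega) j
  have h2 : (3 * 4 ^ m * ((2 * m)! * m !) : ℝ) ≤ 4 * (3 * m)! := by
    exact_mod_cast Nat.factorial_two_mul_mul_factorial_le m
  have p1 : (0 : ℝ) < (3 * m + j)! := by positivity
  have p2 : (0 : ℝ) < (3 * m)! := by positivity
  have p3 : (0 : ℝ) < m ! := by positivity
  calc _ ≤ ((2 * m + j)! : ℝ) / (3 * m + j)! := by gcongr
    _ ≤ ((2 * m)! : ℝ) / (3 * m)! := by rw [div_le_div_iff₀ p1 p2]; exact h1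
    _ ≤ _ := by
      rw [one_div, inv_pow, div_le_iff₀ p2]
      field_simp
      linarith

open Nat in
theorem hasSum_pow_mod_mul_pow_div (r z : ℝ) :
    HasSum (fun k : ℕ => z ^ (k / 3) / (k / 3)! * r ^ (k % 3))
      (Real.exp z * (1 + r + r ^ 2)) := by
  have h1 : HasSum (fun n : ℕ => z ^ n / n !) (Real.exp z) := by
    rw [Real.exp_eq_exp_ℝ]; exact NormedSpace.expSeries_div_hasSum_exp z
  have h2 : HasSum (fun j : Fin 3 => r ^ (j : ℕ)) (1 + r + r ^ 2) := by
    convert hasSum_fintype (fun j : Fin 3 => r ^ (j : ℕ)) using 1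
    simp [Fin.sum_univ_three]
  have h := h1.mul h2 (summable_mul_of_summable_norm h1.summable.norm h2.summable.norm)
  have h3 := (Nat.divModEquiv 3).hasSum_iff.2 h
  have he : (fun k : ℕ => z ^ (k / 3) / (k / 3)! * r ^ (k % 3)) =
      (fun p : ℕ × Fin 3 => z ^ p.1 / p.1 ! * r ^ (p.2 : ℕ)) ∘ Nat.divModEquiv 3 := by
    ext k
    simp [Nat.divModEquiv]
  exact he ▸ h3

open Nat in
theorem Real.abs_pow_div_factorial_mul_inv_Gamma_le {x : ℝ} (hx : 2 / 3 ≤ x) (t : ℝ) (k : ℕ) :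
    |t ^ k / k ! * (Real.Gamma (x - 2 * k / 3))⁻¹| ≤ 8 / 3 * 2 ^ x / Real.Gamma x *
      ((|t| ^ 3 / 4) ^ (k / 3) / (k / 3)! * |t| ^ (k % 3)) := by
  have hGx := Real.Gamma_pos_of_pos (show 0 < x by linarith)
  have hΓ := Real.Gamma_mul_abs_inv_Gamma_sub_le hx (show (0 : ℝ) ≤ 2 * k / 3 by positivity)
  rw [mul_comm, ← le_div_iff₀ hGx] at hΓ
  have hk := Real.Gamma_two_thirds_mul_div_factorial_le k
  have hpow : |t| ^ k = (|t| ^ 3) ^ (k / 3) * |t| ^ (k % 3) := by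
    rw [← pow_mul, ← pow_add, Nat.div_add_mod]
  calc _ = |t| ^ k / k ! * |(Real.Gamma (x - 2 * k / 3))⁻¹| := by
        rw [abs_mul, abs_div, abs_pow, Nat.abs_cast]
    _ ≤ |t| ^ k / k ! * (2 * 2 ^ x * Real.Gamma (2 * k / 3 + 1) / Real.Gamma x) := by gcongr
    _ = 2 * 2 ^ x / Real.Gamma x * |t| ^ k * (Real.Gamma (2 * k / 3 + 1) / k !) := by ring
    _ ≤ 2 * 2 ^ x / Real.Gamma x * |t| ^ k * (4 / 3 * ((1 / 4) ^ (k / 3) / (k / 3)!)) := by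
        gcongr
    _ = _ := by
        rw [hpow, div_eq_mul_one_div (|t| ^ 3) 4, mul_pow]
        ring

open Real in
theorem one_add_add_sq_le_exp {r : ℝ} (hr : 0 ≤ r) :
    1 + r + r ^ 2 ≤ 65 * exp (5 / 108 * r ^ 3) := by
  have h1 := add_one_le_exp (5 / 108 * r ^ 3)
  have h2 : 1 + r + r ^ 2 ≤ 3 * (1 + r ^ 3) := by
    nlinarith [mul_nonneg hr (sq_nonneg (r - 1)), sq_nonneg (r - 1)]
  have h3 : 0 ≤ r ^ 3 := by positivity
  linarith

/-- there is `C > 0` such that for all `y ≥ 1` and all `μ`, the series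
defining `A(y,μ)` converges absolutely and
`|A(y,μ)| ≤ C e^{|μ|³/2} (2/3)^{(y+1)/3} / Γ((y+1)/3)`. -/
theorem Afun_abs_bound :
    ∃ C : ℝ, 0 < C ∧ ∀ y : ℝ, 1 ≤ y → ∀ μ : ℝ,
      Summable (fun k : ℕ =>
        |((3 : ℝ) ^ ((2 : ℝ) / 3) * μ / 2) ^ k / k.factorial *
          (Real.Gamma ((y + 1 - 2 * k) / 3))⁻¹|) ∧
      |Afun y μ| ≤
        C * Real.exp (|μ| ^ 3 / 2) * (2 / 3 : ℝ) ^ ((y + 1) / 3) / Real.Gamma ((y + 1) / 3) := by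
  refine ⟨200, by norm_num, fun y hy μ => ?_⟩
  set x : ℝ := (y + 1) / 3 with hx_def
  set t : ℝ := (3 : ℝ) ^ ((2 : ℝ) / 3) * μ / 2 with ht
  have hx : 2 / 3 ≤ x := by linarith
  have hGx := Real.Gamma_pos_of_pos (show 0 < x by linarith)
  have harg : ∀ k : ℕ, (y + 1 - 2 * k) / 3 = x - 2 * k / 3 := fun k => by rw [hx_def]; ring
  have hterm := Real.abs_pow_div_factorial_mul_inv_Gamma_le hx t
  have hsum := (hasSum_pow_mod_mul_pow_div |t| (|t| ^ 3 / 4)).mul_left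
    (8 / 3 * 2 ^ x / Real.Gamma x)
  have habs := Summable.of_nonneg_of_le (fun _ => abs_nonneg _) hterm hsum.summable
  simp only [Afun, harg, ← ht, ← hx_def]
  refine ⟨habs, ?_⟩
  have hS := tsum_of_norm_bounded hsum fun k => (Real.norm_eq_abs _).trans_le (hterm k)
  rw [Real.norm_eq_abs] at hS
  have ht3 : |t| ^ 3 = 9 / 8 * |μ| ^ 3 := by
    have h9 : ((3 : ℝ) ^ ((2 : ℝ) / 3)) ^ 3 = 9 := by
      rw [← Real.rpow_natCast, ← Real.rpow_mul (by norm_num)]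
      norm_num
    rw [ht, abs_div, abs_mul, abs_of_pos (by positivity : (0 : ℝ) < 3 ^ ((2 : ℝ) / 3)), div_pow,
      mul_pow, h9]
    norm_num
    ring
  have hexp : Real.exp (-μ ^ 3 / 6) ≤ Real.exp (|μ| ^ 3 / 6) := by
    gcongr
    rw [← abs_pow]
    exact neg_le_abs _
  have hprod : Real.exp (|μ| ^ 3 / 6) *
      (Real.exp (|t| ^ 3 / 4) * Real.exp (5 / 108 * |t| ^ 3)) = Real.exp (|μ| ^ 3 / 2) := by
    rw [← Real.exp_add, ← Real.exp_add, ht3]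
    ring_nf
  rw [abs_mul, abs_of_pos (by positivity : 0 < Real.exp (-μ ^ 3 / 6) / (3 : ℝ) ^ x)]
  calc _ ≤ Real.exp (|μ| ^ 3 / 6) / (3 : ℝ) ^ x * (8 / 3 * 2 ^ x / Real.Gamma x *
        (Real.exp (|t| ^ 3 / 4) * (65 * Real.exp (5 / 108 * |t| ^ 3)))) := by
        refine mul_le_mul (by gcongr) (hS.trans ?_) (abs_nonneg _) (by positivity)
        gcongr
        exact one_add_add_sq_le_exp (abs_nonneg t)
    _ = 520 / 3 * Real.exp (|μ| ^ 3 / 2) * (2 / 3 : ℝ) ^ x / Real.Gamma x := by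
        rw [← hprod, Real.div_rpow (by norm_num) (by norm_num)]
        ring
    _ ≤ _ := by gcongr; norm_num
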